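/- Let β_ij : U → ℝ (i ≠ j) satisfy the Lamé equations on a nonempty open connected U ⊆ ℝ^N (∂_k β_ij = β_ik β_kj for pairwise distinct i,j,k, and ∂_i β_ij + ∂_j β_ji + Σ_{k≠i,j} β_ki β_kj = 0 for i ≠ j). Let ξ_i : U → ℝ^M and ζ_i : U → ℝ^{M'} be X-solutions for β, with ξ*_i := (∂_i ξ_i + Σ_{k≠i} ξ_k β_ki)ᵀ and ζ*_i := (∂_i ζ_i + Σ_{k≠i} ζ_k β_ki)ᵀ. Let Ω := Ω(ξ,ξ*), Ω(ξ,ζ*), Ω(ζ,ξ*) be potentials satisfying Ω(ξ,ζ*) + Ω(ζ,ξ*)ᵀ = Σ_{k=1}^N ξ_k ζ_kᵀ and Ω + Ωᵀ = Σ_{k=1}^N ξ_k ξ_kᵀ on U, with Ω invertible everywhere. Define β̂_ij := β_ij − ξ*_j Ω⁻¹ ξ_i, ζ̂_i := ζ_i − Ω(ζ,ξ*) Ω⁻¹ ξ_i, and ζ̂*_i := ζ*_i − ξ*_i Ω⁻¹ Ω(ξ,ζ*). Then ζ̂*_i = (∂_i ζ̂_i + Σ_{k≠i} ζ̂_k β̂_ki)ᵀ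 for all i = 1,…,N. -/

import Mathlib

open Matrix Finset

/-- Partial derivative of a scalar function on `ℝ^N` in the `i`-th coordinate direction. -/
noncomputable def pd {N : ℕ} (i : Fin N) (f : (Fin N → ℝ) → ℝ) (u : Fin N → ℝ) : ℝ :=
  fderiv ℝ f u (Pi.single i 1)

/-- The row-vector family `ξ*_i := (∂_i ξ_i + Σ_{k≠i} ξ_k β_ki)ᵀ` associated to an X-solution
`ξ` of the orthogonal (Lamé) reduction. -/
noncomputable def starSol {N M : ℕ} (β : Fin N → Fin N → (Fin N → ℝ) → ℝ)
    (ξ : Fin N → (Fin N → ℝ) → Fin M → ℝ) (i : Fin N) (u : Fin N → ℝ) : Fin M → ℝ :=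
  fun b => pd i (fun v => ξ i v b) u + ∑ k ∈ Finset.univ.erase i, ξ k u b * β k i u

/-- The transformed rotation coefficients `β̂_ij := β_ij − ξ*_j Ω⁻¹ ξ_i`. -/
noncomputable def betaHat {N M : ℕ} (β : Fin N → Fin N → (Fin N → ℝ) → ℝ)
    (ξ : Fin N → (Fin N → ℝ) → Fin M → ℝ)
    (Ω : (Fin N → ℝ) → Matrix (Fin M) (Fin M) ℝ)
    (i j : Fin N) (u : Fin N → ℝ) : ℝ :=
  β i j u - (starSol β ξ j u ᵥ* (Ω u)⁻¹) ⬝ᵥ ξ i u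

/-- The transformed X-solution `ζ̂_i := ζ_i − Ω(ζ,ξ*) Ω⁻¹ ξ_i`. -/
noncomputable def zetaHat {N M M' : ℕ}
    (ζ : Fin N → (Fin N → ℝ) → Fin M' → ℝ)
    (ξ : Fin N → (Fin N → ℝ) → Fin M → ℝ)
    (Ωζξ : (Fin N → ℝ) → Matrix (Fin M') (Fin M) ℝ)
    (Ω : (Fin N → ℝ) → Matrix (Fin M) (Fin M) ℝ)
    (i : Fin N) (u : Fin N → ℝ) : Fin M' → ℝ :=
  ζ i u - (Ωζξ u * (Ω u)⁻¹) *ᵥ ξ i u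

theorem pd_sub {N : ℕ} (i : Fin N) {f g : (Fin N → ℝ) → ℝ} {u : Fin N → ℝ}
    (hf : DifferentiableAt ℝ f u) (hg : DifferentiableAt ℝ g u) :
    pd i (fun v => f v - g v) u = pd i f u - pd i g u := by
  simp [pd, fderiv_fun_sub hf hg]

/-- Leibniz rule for the dot product. -/
theorem pd_dotProduct {N m : ℕ} (i : Fin N) {f g : (Fin N → ℝ) → Fin m → ℝ} {u : Fin N → ℝ}
    (hf : ∀ c, DifferentiableAt ℝ (fun v => f v c) u)
    (hg : ∀ c, DifferentiableAt ℝ (fun v => g v c) u) :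
    pd i (fun v => f v ⬝ᵥ g v) u =
      (fun c => pd i (fun v => f v c) u) ⬝ᵥ g u + f u ⬝ᵥ (fun c => pd i (fun v => g v c) u) := by
  simp only [pd, dotProduct]
  rw [fderiv_fun_sum fun c _ => (hf c).fun_mul (hg c)]
  simp only [ContinuousLinearMap.sum_apply, ← Finset.sum_add_distrib]
  refine Finset.sum_congr rfl fun c _ => ?_
  rw [fderiv_fun_mul (hf c) (hg c)]
  simp only [_root_.add_apply, _root_.smul_apply, smul_eq_mul]
  ring

theorem differentiableAt_dotProduct {E : Type*} [NormedAddCommGroup E] [NormedSpace ℝ E] {m : ℕ}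
    {f g : E → Fin m → ℝ} {u : E}
    (hf : ∀ c, DifferentiableAt ℝ (fun v => f v c) u)
    (hg : ∀ c, DifferentiableAt ℝ (fun v => g v c) u) :
    DifferentiableAt ℝ (fun v => f v ⬝ᵥ g v) u :=
  DifferentiableAt.fun_sum fun c _ => (hf c).mul (hg c)

theorem differentiableAt_matrix_det {E : Type*} [NormedAddCommGroup E] [NormedSpace ℝ E] {m : ℕ}
    {A : E → Matrix (Fin m) (Fin m) ℝ} {u : E}
    (hA : ∀ a b, DifferentiableAt ℝ (fun v => A v a b) u) :
    DifferentiableAt ℝ (fun v => (A v).det) u := by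
  simp only [Matrix.det_apply']
  exact DifferentiableAt.fun_sum fun σ _ =>
    (HasFDerivAt.finsetProd fun c _ => (hA (σ c) c).hasFDerivAt).differentiableAt.const_mul _

theorem differentiableAt_matrix_inv {E : Type*} [NormedAddCommGroup E] [NormedSpace ℝ E] {m : ℕ}
    {A : E → Matrix (Fin m) (Fin m) ℝ} {u : E}
    (hA : ∀ a b, DifferentiableAt ℝ (fun v => A v a b) u) (hu : IsUnit (A u).det)
    (a b : Fin m) : DifferentiableAt ℝ (fun v => (A v)⁻¹ a b) u := by
  simp only [Matrix.inv_def, Ring.inverse_eq_inv', Matrix.smul_apply, smul_eq_mul,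
    Matrix.adjugate_apply]
  refine ((differentiableAt_matrix_det hA).inv hu.ne_zero).mul
    (differentiableAt_matrix_det fun c d => ?_)
  rcases eq_or_ne c b with rfl | h
  · simp
  · simpa [Matrix.updateRow_ne h] using hA c d

/-- If `q = p Ω⁻¹`, with `∂_i p = z s` and `∂_i Ω = x sᵀ`, then
`∂_i q = (z - q ⬝ x) s Ω⁻¹`. -/
theorem pd_vecMul_inv {N m : ℕ} (i : Fin N) {U : Set (Fin N → ℝ)} (hU : IsOpen U)
    {A : (Fin N → ℝ) → Matrix (Fin m) (Fin m) ℝ} {p : (Fin N → ℝ) → Fin m → ℝ}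
    {u : Fin N → ℝ} (hu : u ∈ U)
    (hA : ∀ a b, DifferentiableAt ℝ (fun v => A v a b) u)
    (hp : ∀ a, DifferentiableAt ℝ (fun v => p v a) u)
    (hinv : ∀ v ∈ U, IsUnit (A v).det) {x s : Fin m → ℝ} {z : ℝ}
    (hdA : ∀ a b, pd i (fun v => A v a b) u = x a * s b)
    (hdp : ∀ a, pd i (fun v => p v a) u = z * s a) :
    (fun c => pd i (fun v => (p v ᵥ* (A v)⁻¹) c) u)
      = (z - (p u ᵥ* (A u)⁻¹) ⬝ᵥ x) • (s ᵥ* (A u)⁻¹) := by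
  have hq : ∀ c, DifferentiableAt ℝ (fun v => (p v ᵥ* (A v)⁻¹) c) u := fun c =>
    differentiableAt_dotProduct hp fun d => differentiableAt_matrix_inv hA (hinv u hu) d c
  have key : (fun c => pd i (fun v => (p v ᵥ* (A v)⁻¹) c) u) ᵥ* A u
      = (z - (p u ᵥ* (A u)⁻¹) ⬝ᵥ x) • s := by
    funext b
    have hloc : (fun v => (p v ᵥ* (A v)⁻¹) ⬝ᵥ fun c => A v c b) =ᶠ[nhds u] fun v => p v b := by
      filter_upwards [hU.mem_nhds hu] with v hv
      have h : ((p v ᵥ* (A v)⁻¹) ᵥ* A v) b = p v b := by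
        rw [Matrix.vecMul_vecMul, Matrix.nonsing_inv_mul _ (hinv v hv), Matrix.vecMul_one]
      exact h
    have h₁ : pd i (fun v => (p v ᵥ* (A v)⁻¹) ⬝ᵥ fun c => A v c b) u = z * s b := by
      rw [← hdp b, pd, pd, hloc.fderiv_eq]
    rw [pd_dotProduct i hq fun c => hA c b] at h₁
    have h₂ : ((p u ᵥ* (A u)⁻¹) ⬝ᵥ fun c => pd i (fun v => A v c b) u)
        = ((p u ᵥ* (A u)⁻¹) ⬝ᵥ x) * s b := by
      simp only [hdA, dotProduct, Finset.sum_mul, mul_assoc]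
    rw [h₂] at h₁
    rw [Pi.smul_apply, smul_eq_mul, sub_mul]
    exact eq_sub_of_add_eq h₁
  rw [← Matrix.smul_vecMul, ← key, Matrix.vecMul_vecMul, Matrix.mul_nonsing_inv _ (hinv u hu),
    Matrix.vecMul_one]

/-- Contraction of the orthogonality constraints with the rows `q` and `r`. -/
theorem sum_sub_dotProduct_mul_dotProduct {N m : ℕ} (A : Matrix (Fin m) (Fin m) ℝ)
    (ξ : Fin N → Fin m → ℝ) (ζ : Fin N → ℝ) (q r p Q : Fin m → ℝ)
    (hQ : ∀ a, Q a + p a = ∑ k, ξ k a * ζ k)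
    (hA : ∀ a b, A a b + A b a = ∑ k, ξ k a * ξ k b)
    (hq : q ᵥ* A = p) :
    ∑ k, (ζ k - q ⬝ᵥ ξ k) * (r ⬝ᵥ ξ k) = r ⬝ᵥ Q - q ⬝ᵥ (r ᵥ* A) := by
  have h₁ : ∑ k, ζ k * (r ⬝ᵥ ξ k) = r ⬝ᵥ Q + r ⬝ᵥ p := by
    rw [← dotProduct_add]
    simp only [dotProduct, Pi.add_apply, hQ, Finset.mul_sum]
    rw [Finset.sum_comm]
    exact Finset.sum_congr rfl fun _ _ => Finset.sum_congr rfl fun _ _ => by ring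
  have h₂ : ∑ k, (q ⬝ᵥ ξ k) * (r ⬝ᵥ ξ k) = q ⬝ᵥ ((A + Aᵀ) *ᵥ r) := by
    simp only [dotProduct, Matrix.mulVec, Matrix.add_apply, Matrix.transpose_apply, hA,
      Finset.mul_sum, Finset.sum_mul]
    rw [Finset.sum_comm]
    simp_rw [Finset.sum_comm (s := (Finset.univ : Finset (Fin N)))]
    rw [Finset.sum_comm]
    exact Finset.sum_congr rfl fun _ _ => Finset.sum_congr rfl fun _ _ =>
      Finset.sum_congr rfl fun _ _ => by ring
  simp only [sub_mul, Finset.sum_sub_distrib, h₁, h₂]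
  rw [Matrix.add_mulVec, dotProduct_add, Matrix.dotProduct_mulVec, hq, Matrix.mulVec_transpose,
    dotProduct_comm r p]
  ring

/-- Under the orthogonality constraints on the potentials, the transformed
`ζ̂*_i := ζ*_i − ξ*_i Ω⁻¹ Ω(ξ,ζ*)` coincides with `(∂_i ζ̂_i + Σ_{k≠i} ζ̂_k β̂_ki)ᵀ`. -/
theorem stmt_15 {N M M' : ℕ} (hN : 2 ≤ N)
    (U : Set (Fin N → ℝ)) (hUopen : IsOpen U) (hUconn : IsConnected U)
    (β : Fin N → Fin N → (Fin N → ℝ) → ℝ)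
    (hβsmooth : ∀ i j : Fin N, i ≠ j → ContDiffOn ℝ (⊤ : ℕ∞) (β i j) U)
    (hLame1 : ∀ i j k : Fin N, i ≠ j → j ≠ k → i ≠ k → ∀ u ∈ U,
      pd k (β i j) u = β i k u * β k j u)
    (hLame2 : ∀ i j : Fin N, i ≠ j → ∀ u ∈ U,
      pd i (β i j) u + pd j (β j i) u
        + ∑ k ∈ (Finset.univ.erase i).erase j, β k i u * β k j u = 0)
    (ξ : Fin N → (Fin N → ℝ) → Fin M → ℝ)
    (hξsmooth : ∀ (j : Fin N) (a : Fin M), ContDiffOn ℝ (⊤ : ℕ∞) (fun u => ξ j u a) U)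
    (hξX : ∀ i j : Fin N, i ≠ j → ∀ u ∈ U, ∀ a : Fin M,
      pd i (fun v => ξ j v a) u = β j i u * ξ i u a)
    (ζ : Fin N → (Fin N → ℝ) → Fin M' → ℝ)
    (hζsmooth : ∀ (j : Fin N) (a : Fin M'), ContDiffOn ℝ (⊤ : ℕ∞) (fun u => ζ j u a) U)
    (hζX : ∀ i j : Fin N, i ≠ j → ∀ u ∈ U, ∀ a : Fin M',
      pd i (fun v => ζ j v a) u = β j i u * ζ i u a)
    (Ω : (Fin N → ℝ) → Matrix (Fin M) (Fin M) ℝ)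
    (hΩsmooth : ∀ (a b : Fin M), ContDiffOn ℝ (⊤ : ℕ∞) (fun u => Ω u a b) U)
    (hΩ : ∀ i : Fin N, ∀ u ∈ U, ∀ (a b : Fin M),
      pd i (fun v => Ω v a b) u = ξ i u a * starSol β ξ i u b)
    (Ωξζ : (Fin N → ℝ) → Matrix (Fin M) (Fin M') ℝ)
    (hΩξζsmooth : ∀ (a : Fin M) (b : Fin M'), ContDiffOn ℝ (⊤ : ℕ∞) (fun u => Ωξζ u a b) U)
    (hΩξζ : ∀ i : Fin N, ∀ u ∈ U, ∀ (a : Fin M) (b : Fin M'),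
      pd i (fun v => Ωξζ v a b) u = ξ i u a * starSol β ζ i u b)
    (Ωζξ : (Fin N → ℝ) → Matrix (Fin M') (Fin M) ℝ)
    (hΩζξsmooth : ∀ (a : Fin M') (b : Fin M), ContDiffOn ℝ (⊤ : ℕ∞) (fun u => Ωζξ u a b) U)
    (hΩζξ : ∀ i : Fin N, ∀ u ∈ U, ∀ (a : Fin M') (b : Fin M),
      pd i (fun v => Ωζξ v a b) u = ζ i u a * starSol β ξ i u b)
    (hconstr1 : ∀ u ∈ U, ∀ (a : Fin M) (b : Fin M'),
      Ωξζ u a b + Ωζξ u b a = ∑ k : Fin N, ξ k u a * ζ k u b)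
    (hconstr2 : ∀ u ∈ U, ∀ (a b : Fin M),
      Ω u a b + Ω u b a = ∑ k : Fin N, ξ k u a * ξ k u b)
    (hΩinv : ∀ u ∈ U, IsUnit (Ω u).det) :
    ∀ i : Fin N, ∀ u ∈ U, ∀ b : Fin M',
      starSol β ζ i u b - ((starSol β ξ i u ᵥ* (Ω u)⁻¹) ᵥ* Ωξζ u) b
        = pd i (fun v => zetaHat ζ ξ Ωζξ Ω i v b) u
          + ∑ k ∈ Finset.univ.erase i,
              zetaHat ζ ξ Ωζξ Ω k u b * betaHat β ξ Ω k i u := by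
  intro i u hu b
  have hnhds := hUopen.mem_nhds hu
  have hdiff : ∀ {f : (Fin N → ℝ) → ℝ}, ContDiffOn ℝ (⊤ : ℕ∞) f U → DifferentiableAt ℝ f u :=
    fun hf => (hf.contDiffAt hnhds).differentiableAt (by simp)
  have hdΩ := fun a c => hdiff (hΩsmooth a c)
  have hdP := fun c => hdiff (hΩζξsmooth b c)
  have hdξ := fun c => hdiff (hξsmooth i c)
  have hzeta : ∀ k v, zetaHat ζ ξ Ωζξ Ω k v b
      = ζ k v b - (Ωζξ v b ᵥ* (Ω v)⁻¹) ⬝ᵥ ξ k v := fun k v => by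
    simp only [zetaHat, Pi.sub_apply]
    rfl
  set r := starSol β ξ i u ᵥ* (Ω u)⁻¹ with hr
  set q := Ωζξ u b ᵥ* (Ω u)⁻¹ with hq
  have hrΩ : r ᵥ* Ω u = starSol β ξ i u := by
    rw [hr, Matrix.vecMul_vecMul, Matrix.nonsing_inv_mul _ (hΩinv u hu), Matrix.vecMul_one]
  have hqΩ : q ᵥ* Ω u = Ωζξ u b := by
    rw [hq, Matrix.vecMul_vecMul, Matrix.nonsing_inv_mul _ (hΩinv u hu), Matrix.vecMul_one]
  have hdq : ∀ c, DifferentiableAt ℝ (fun v => (Ωζξ v b ᵥ* (Ω v)⁻¹) c) u := fun c =>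
    differentiableAt_dotProduct hdP fun d => differentiableAt_matrix_inv hdΩ (hΩinv u hu) d c
  have hpd : pd i (fun v => zetaHat ζ ξ Ωζξ Ω i v b) u
      = pd i (fun v => ζ i v b) u - ((ζ i u b - q ⬝ᵥ ξ i u) * (r ⬝ᵥ ξ i u)
        + q ⬝ᵥ fun c => pd i (fun v => ξ i v c) u) := by
    simp only [hzeta]
    rw [pd_sub i (hdiff (hζsmooth i b)) (differentiableAt_dotProduct hdq hdξ),
      pd_dotProduct i hdq hdξ,
      pd_vecMul_inv i hUopen hu hdΩ hdP hΩinv (hΩ i u hu) (hΩζξ i u hu b),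
      smul_dotProduct, smul_eq_mul]
  have hcontr := sum_sub_dotProduct_mul_dotProduct (Ω u) (fun k => ξ k u) (fun k => ζ k u b)
    q r (Ωζξ u b) (fun a => Ωξζ u a b) (fun a => hconstr1 u hu a b) (hconstr2 u hu) hqΩ
  rw [hrΩ, ← Finset.add_sum_erase _ _ (Finset.mem_univ i)] at hcontr
  have hstar : q ⬝ᵥ starSol β ξ i u = (q ⬝ᵥ fun c => pd i (fun v => ξ i v c) u)
      + ∑ k ∈ Finset.univ.erase i, (q ⬝ᵥ ξ k u) * β k i u := by
    simp only [starSol, dotProduct, mul_add, Finset.sum_add_distrib, Finset.mul_sum,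
      Finset.sum_mul, mul_assoc]
    rw [Finset.sum_comm (s := Finset.univ.erase i)]
  have hsum : ∑ k ∈ Finset.univ.erase i, zetaHat ζ ξ Ωζξ Ω k u b * betaHat β ξ Ω k i u
      = ∑ k ∈ Finset.univ.erase i, ζ k u b * β k i u
        - ∑ k ∈ Finset.univ.erase i, (q ⬝ᵥ ξ k u) * β k i u
        - ∑ k ∈ Finset.univ.erase i, (ζ k u b - q ⬝ᵥ ξ k u) * (r ⬝ᵥ ξ k u) := by
    rw [← Finset.sum_sub_distrib, ← Finset.sum_sub_distrib]
    refine Finset.sum_congr rfl fun k _ => ?_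
    rw [hzeta, betaHat]
    ring
  have hQ : (r ᵥ* Ωξζ u) b = r ⬝ᵥ fun a => Ωξζ u a b := rfl
  have hζstar : starSol β ζ i u b
      = pd i (fun v => ζ i v b) u + ∑ k ∈ Finset.univ.erase i, ζ k u b * β k i u := rfl
  rw [hpd, hsum, hQ, hζstar]
  linarith
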